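/- Let D be an integer with D > 6889 (= 83²) and D ≡ 4 (mod 105). Then every element of 𝒮_D is equivalent, under the equivalence relation ∼ on 𝒮_D, to an element of 𝒰_D. -/

import Mathlib

/-- The set `𝒮_D = {e ∈ ℤ : e² ≡ D (mod 8), e² < D and (e+4)² < D}`. -/
def SD (D : ℤ) : Set ℤ := {e : ℤ | e ^ 2 % 8 = D % 8 ∧ e ^ 2 < D ∧ (e + 4) ^ 2 < D}

/-- The generating relation on `𝒮_D`: `e ∼ -e-4q` whenever `q` is a positive integer
such that `-e-4q ∈ 𝒮_D` and `gcd(q, w) = 1` where `w = (D-e²)/8`. -/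
def SMove (D : ℤ) (e e' : ℤ) : Prop :=
  e ∈ SD D ∧ e' ∈ SD D ∧
    ∃ q : ℤ, 0 < q ∧ e' = -e - 4 * q ∧ Int.gcd q ((D - e ^ 2) / 8) = 1

/-- The set `𝒯_D = {e ∈ 𝒮_D : e - 24 ∈ 𝒮_D and e + 32 ∈ 𝒮_D}`. -/
def TD (D : ℤ) : Set ℤ := {e : ℤ | e ∈ SD D ∧ e - 24 ∈ SD D ∧ e + 32 ∈ SD D}

/-- The set `𝒰_D = {e ∈ 𝒯_D : e ≢ -2 (mod 105)}`. -/
def UD (D : ℤ) : Set ℤ := {e : ℤ | e ∈ TD D ∧ ¬ ((105 : ℤ) ∣ (e + 2))}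

/-- The product of the primes below `n` outgrows `100 * n ^ 2`. -/
lemma hundred_mul_sq_le_prod_primes (n : ℕ) (hn : 17 ≤ n) :
    100 * n ^ 2 ≤ ∏ p ∈ (Finset.range n).filter Nat.Prime, p := by
  induction n using Nat.strong_induction_on with
  | _ n ih =>
    rcases lt_or_ge n 36 with h | h
    · interval_cases n <;> decide +kernel
    · obtain ⟨p, hp, h1, h2⟩ := Nat.exists_prime_lt_and_le_two_mul ((n - 1) / 2) (by omega)
      have hpn : p < n := by omega
      have hsub : insert p ((Finset.range p).filter Nat.Prime) ⊆
          (Finset.range n).filter Nat.Prime := by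
        intro x hx
        rcases Finset.mem_insert.1 hx with rfl | hx
        · simp [hp, hpn]
        · simp only [Finset.mem_filter, Finset.mem_range] at hx ⊢
          exact ⟨by omega, hx.2⟩
      have hle := Finset.prod_le_prod_of_subset_of_one_le' hsub (f := fun p : ℕ => p)
        (fun i hi _ => (Finset.mem_filter.1 hi).2.one_le)
      rw [Finset.prod_insert (by simp)] at hle
      have h3 := Nat.mul_le_mul_left p (ih p hpn (by omega))
      have h4 : n ≤ 2 * p := by omega
      have h5 : n ^ 2 ≤ (2 * p) ^ 2 := Nat.pow_le_pow_left h4 2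
      have h6 : 17 ≤ p := by omega
      nlinarith [Nat.mul_le_mul_right (p ^ 2) h6]

/-- The least prime not dividing a positive integer `w` is at most `13` or at most `√w / 10`. -/
lemma exists_least_prime_not_dvd (w : ℤ) (hw : 0 < w) :
    ∃ q : ℕ, q.Prime ∧ ¬ (q : ℤ) ∣ w ∧ (∀ p : ℕ, p.Prime → p < q → (p : ℤ) ∣ w) ∧
      (q ≤ 13 ∨ 17 ≤ q ∧ 100 * (q : ℤ) ^ 2 ≤ w) := by
  classical
  lift w to ℕ using hw.le
  have hw0 : 0 < w := by exact_mod_cast hw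
  have hex : ∃ q : ℕ, q.Prime ∧ ¬ (q : ℤ) ∣ w := by
    obtain ⟨q, hq, hqp⟩ := Nat.exists_infinite_primes (w + 1)
    exact ⟨q, hqp, fun h => by
      have := Nat.le_of_dvd hw0 (Int.natCast_dvd_natCast.1 h)
      omega⟩
  have hmin : ∀ p : ℕ, p.Prime → p < Nat.find hex → (p : ℤ) ∣ w := fun p hp hlt => by
    by_contra h
    exact Nat.find_min hex hlt ⟨hp, h⟩
  refine ⟨Nat.find hex, (Nat.find_spec hex).1, (Nat.find_spec hex).2, hmin, ?_⟩
  have hprime := (Nat.find_spec hex).1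
  generalize Nat.find hex = q at hmin hprime
  rcases lt_or_ge q 17 with h | h
  · left
    by_contra h'
    interval_cases q <;> revert hprime <;> norm_num
  · right
    refine ⟨h, ?_⟩
    have hdvd : ∏ p ∈ (Finset.range q).filter Nat.Prime, p ∣ w :=
      Finset.prod_primes_dvd w (fun p hp => (Finset.mem_filter.1 hp).2.prime) fun p hp => by
        simp only [Finset.mem_filter, Finset.mem_range] at hp
        exact Int.natCast_dvd_natCast.1 (hmin p hp.2 hp.1)
    exact_mod_cast (hundred_mul_sq_le_prod_primes q h).trans (Nat.le_of_dvd hw0 hdvd)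

/-- A natural number congruent to `2` modulo `3` has a prime factor congruent to `2` modulo `3`. -/
lemma exists_prime_dvd_mod_three_eq_two (n : ℕ) (hn : n % 3 = 2) :
    ∃ p : ℕ, p.Prime ∧ p ∣ n ∧ p % 3 = 2 := by
  induction n using Nat.strong_induction_on with
  | _ n ih =>
    have hp : n.minFac.Prime := Nat.minFac_prime (by omega)
    obtain ⟨k, hk⟩ := n.minFac_dvd
    have hmod : (n.minFac % 3) * (k % 3) % 3 = 2 := by rw [← Nat.mul_mod, ← hk, hn]
    have h3 : n.minFac % 3 < 3 := Nat.mod_lt _ (by norm_num)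
    have h3' : k % 3 < 3 := Nat.mod_lt _ (by norm_num)
    generalize n.minFac = p at *
    by_cases hp2 : p % 3 = 2
    · exact ⟨p, hp, ⟨k, hk⟩, hp2⟩
    · have hk2 : k % 3 = 2 := by
        interval_cases p % 3 <;> omega
      have hkn : k < n := by
        have := hp.two_le
        nlinarith [show 0 < k by omega]
      obtain ⟨r, hr, hrk, hr2⟩ := ih k hkn hk2
      exact ⟨r, hr, hrk.trans ⟨p, by rw [hk, mul_comm]⟩, hr2⟩

lemma int_gcd_eq_one_of_prime_not_dvd {q : ℕ} {w : ℤ} (hq : q.Prime) (h : ¬ (q : ℤ) ∣ w) :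
    Int.gcd q w = 1 :=
  Int.isCoprime_iff_gcd_eq_one.1
    ((Prime.coprime_iff_not_dvd (Nat.prime_iff_prime_int.1 hq)).2 h)

lemma exists_floor_sqrt (D : ℤ) (hD : 6889 < D) :
    ∃ s : ℤ, 83 ≤ s ∧ s ^ 2 < D ∧ D ≤ (s + 1) ^ 2 := by
  refine ⟨Int.sqrt (D - 1), ?_, ?_, ?_⟩
  · rw [Int.sqrt]
    have : 83 ≤ Nat.sqrt (D - 1).toNat := Nat.le_sqrt.2 (by omega)
    exact_mod_cast this
  · have := Nat.sqrt_le' (D - 1).toNat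
    zify at this
    rw [Int.sqrt]
    omega
  · have := Nat.lt_succ_sqrt' (D - 1).toNat
    zify at this
    rw [Int.sqrt]
    omega

lemma sq_add_four_mul_emod (e k : ℤ) : (e + 4 * k) ^ 2 % 8 = e ^ 2 % 8 := by
  rw [show (e + 4 * k) ^ 2 = e ^ 2 + 8 * (e * k + 2 * k ^ 2) by ring, Int.add_mul_emod_self_left]

lemma sq_neg_sub_emod (e k : ℤ) : (-e - 4 * k) ^ 2 % 8 = e ^ 2 % 8 := by
  rw [show -e - 4 * k = -(e + 4 * k) by ring, neg_sq, sq_add_four_mul_emod]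

section Bounds

variable {D s : ℤ}

lemma sq_lt_iff_of_floor_sqrt (hs : 0 ≤ s) (h1 : s ^ 2 < D) (h2 : D ≤ (s + 1) ^ 2) (x : ℤ) :
    x ^ 2 < D ↔ -s ≤ x ∧ x ≤ s := by
  constructor
  · intro h
    have := abs_lt_of_sq_lt_sq' (h.trans_le h2) (by omega)
    omega
  · rintro ⟨h3, h4⟩
    exact (sq_le_sq' h3 h4).trans_lt h1

lemma mem_SD_iff (hs : 0 ≤ s) (h1 : s ^ 2 < D) (h2 : D ≤ (s + 1) ^ 2) (e : ℤ) :
    e ∈ SD D ↔ e ^ 2 % 8 = D % 8 ∧ -s ≤ e ∧ e ≤ s - 4 := by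
  simp only [SD, Set.mem_ofPred_eq, sq_lt_iff_of_floor_sqrt hs h1 h2]
  constructor
  · rintro ⟨h, h3, h4⟩
    exact ⟨h, by omega, by omega⟩
  · rintro ⟨h, h3, h4⟩
    exact ⟨h, by omega, by omega⟩

lemma mem_TD_iff (hs : 0 ≤ s) (h1 : s ^ 2 < D) (h2 : D ≤ (s + 1) ^ 2) (e : ℤ) :
    e ∈ TD D ↔ e ^ 2 % 8 = D % 8 ∧ 24 - s ≤ e ∧ e ≤ s - 36 := by
  have h3 : (e - 24) ^ 2 % 8 = e ^ 2 % 8 := by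
    rw [← sq_add_four_mul_emod e (-6)]
    ring_nf
  have h4 : (e + 32) ^ 2 % 8 = e ^ 2 % 8 := sq_add_four_mul_emod e 8
  simp only [TD, Set.mem_ofPred_eq, mem_SD_iff hs h1 h2, h3, h4]
  omega

end Bounds

section Moves

variable {D : ℤ}

lemma neg_sub_four_mem_SD {e : ℤ} (he : e ∈ SD D) : -e - 4 ∈ SD D := by
  obtain ⟨h1, h2, h3⟩ := he
  have h4 := sq_neg_sub_emod e 1
  rw [mul_one] at h4
  refine ⟨h4.trans h1, ?_, ?_⟩
  · rwa [show (-e - 4) ^ 2 = (e + 4) ^ 2 by ring]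
  · rwa [show (-e - 4 + 4) ^ 2 = e ^ 2 by ring]

lemma eqvGen_neg_sub_four {e : ℤ} (he : e ∈ SD D) :
    Relation.EqvGen (SMove D) e (-e - 4) :=
  .rel _ _ ⟨he, neg_sub_four_mem_SD he, 1, by norm_num, by ring, by simp⟩

lemma eqvGen_add {e q : ℤ} (he : e ∈ SD D) (he' : e + 4 * (q - 1) ∈ SD D) (hq : 0 < q)
    (hg : Int.gcd q ((D - e ^ 2) / 8) = 1) :
    Relation.EqvGen (SMove D) e (e + 4 * (q - 1)) := by
  have h1 := neg_sub_four_mem_SD he'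
  have h2 := eqvGen_neg_sub_four he'
  rw [show -(e + 4 * (q - 1)) - 4 = -e - 4 * q by ring] at h1 h2
  exact (Relation.EqvGen.rel _ _ ⟨he, h1, q, hq, rfl, hg⟩).trans _ _ _ h2.symm

lemma eqvGen_sub {e q : ℤ} (he : e ∈ SD D) (he' : e - 4 * (q - 1) ∈ SD D) (hq : 0 < q)
    (hg : Int.gcd q ((D - (e + 4) ^ 2) / 8) = 1) :
    Relation.EqvGen (SMove D) e (e - 4 * (q - 1)) := by
  have h1 := neg_sub_four_mem_SD he'
  have h2 := eqvGen_neg_sub_four he'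
  rw [show -(e - 4 * (q - 1)) - 4 = (-e - 4) + 4 * (q - 1) by ring] at h1 h2
  refine (eqvGen_neg_sub_four he).trans _ _ _
    ((eqvGen_add (neg_sub_four_mem_SD he) h1 hq ?_).trans _ _ _ h2.symm)
  rwa [show (-e - 4) ^ 2 = (e + 4) ^ 2 by ring]

end Moves

/-- Every element of `SD D` is equivalent to one in the left half of `TD D`. -/
lemma exists_eqvGen_le_neg_two {D s : ℤ} (hs : 83 ≤ s) (h1 : s ^ 2 < D) (h2 : D ≤ (s + 1) ^ 2)
    (e : ℤ) (he : e ∈ SD D) :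
    ∃ f ∈ SD D, 24 - s ≤ f ∧ f ≤ -2 ∧ Relation.EqvGen (SMove D) e f := by
  have key : ∀ n : ℕ, ∀ e ∈ SD D, 24 - s ≤ e → e ≤ -2 + n →
      ∃ f ∈ SD D, 24 - s ≤ f ∧ f ≤ -2 ∧ Relation.EqvGen (SMove D) e f := by
    intro n
    induction n with
    | zero => exact fun e he h3 h4 => ⟨e, he, h3, by simpa using h4, .refl e⟩
    | succ n ih =>
      intro e he h3 h4
      push_cast at h4
      by_cases h5 : e ≤ -2
      · exact ⟨e, he, h3, h5, .refl e⟩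
      by_cases h6 : e ≤ s - 28
      · exact ⟨-e - 4, neg_sub_four_mem_SD he, by omega, by omega, eqvGen_neg_sub_four he⟩
      have he' := (mem_SD_iff (by omega) h1 h2 e).1 he
      have hmod : (e + 4) ^ 2 % 8 = e ^ 2 % 8 := sq_add_four_mul_emod e 1
      have hlt : (e + 4) ^ 2 < D := he.2.2
      obtain ⟨q, hq, hqw, -, hbound⟩ :=
        exists_least_prime_not_dvd ((D - (e + 4) ^ 2) / 8) (by omega)
      have hw : D - (e + 4) ^ 2 ≤ 48 * s := by nlinarith
      have hq2 := hq.two_le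
      have hq4 : 4 * (q : ℤ) ≤ 52 ∨ 4 * (q : ℤ) ≤ s := by
        rcases hbound with h | ⟨-, h⟩
        · omega
        · right
          have : (q : ℤ) ≤ (q : ℤ) ^ 2 := by nlinarith
          omega
      have hmem : e - 4 * ((q : ℤ) - 1) ∈ SD D := by
        rw [mem_SD_iff (by omega) h1 h2]
        refine ⟨?_, by omega, by omega⟩
        rw [← he'.1, ← sq_add_four_mul_emod e (-((q : ℤ) - 1))]
        congr 2
        ring
      obtain ⟨f, hf, hf1, hf2, hf3⟩ := ih _ hmem (by omega) (by omega)
      exact ⟨f, hf, hf1, hf2, (eqvGen_sub he hmem (by omega)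
        (int_gcd_eq_one_of_prime_not_dvd hq hqw)).trans _ _ _ hf3⟩
  have he' := (mem_SD_iff (by omega) h1 h2 e).1 he
  by_cases h : -2 ≤ e
  · exact key (e + 2).toNat e he (by omega) (by omega)
  · obtain ⟨f, hf, hf1, hf2, hf3⟩ :=
      key (-e - 2).toNat (-e - 4) (neg_sub_four_mem_SD he) (by omega) (by omega)
    exact ⟨f, hf, hf1, hf2, (eqvGen_neg_sub_four he).trans _ _ _ hf3⟩

/-- If the prime `p` divides `D - e ^ 2` and `q ≡ 2 (mod p)`, then `p` cannot divide both
`D - g ^ 2` and `D - (g + 4) ^ 2` for `g = e + 4 * (q - 1)`. -/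
lemma not_dvd_or_not_dvd_of_dvd_sub_two {D e q : ℤ} {p : ℕ} (hp : p.Prime) (hp2 : p ≠ 2)
    (hpq : (p : ℤ) ∣ q - 2) (hpe : (p : ℤ) ∣ D - e ^ 2) :
    ¬ (p : ℤ) ∣ D - (e + 4 * (q - 1)) ^ 2 ∨ ¬ (p : ℤ) ∣ D - (e + 4 * (q - 1) + 4) ^ 2 := by
  by_contra! h
  obtain ⟨ha, hb⟩ := h
  have hpp := Nat.prime_iff_prime_int.1 hp
  have hodd : ∀ n : ℕ, ¬ (p : ℤ) ∣ 2 ^ n := fun n hd => by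
    have := hpp.dvd_of_dvd_pow hd
    have := (Nat.prime_dvd_prime_iff_eq hp Nat.prime_two).1 (by exact_mod_cast this)
    exact hp2 this
  obtain ⟨a, ha⟩ := ha
  obtain ⟨b, hb⟩ := hb
  obtain ⟨c, hc⟩ := hpq
  obtain ⟨d, hd⟩ := hpe
  have hc' : q = p * c + 2 := by linarith
  subst hc'
  have h1 : (p : ℤ) ∣ 2 ^ 3 * (e + 2) :=
    ⟨d - a - 8 * e * c - 32 * c - 16 * p * c ^ 2, by linear_combination hd - ha⟩
  have h2 : (p : ℤ) ∣ 2 ^ 4 * (e + 4) :=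
    ⟨d - b - 8 * e * c - 64 * c - 16 * p * c ^ 2, by linear_combination hd - hb⟩
  have h3 := (hpp.dvd_or_dvd h1).resolve_left (hodd 3)
  have h4 := (hpp.dvd_or_dvd h2).resolve_left (hodd 4)
  apply hodd 1
  have h5 := dvd_sub h4 h3
  rwa [show e + 4 - (e + 2) = 2 ^ 1 by ring] at h5

lemma not_dvd_ediv_eight {p : ℕ} {m : ℤ} (hm : (8 : ℤ) ∣ m) (h : ¬ (p : ℤ) ∣ m) :
    ¬ (p : ℤ) ∣ m / 8 := by
  intro hd
  apply h
  rw [← Int.ediv_mul_cancel hm]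
  exact hd.mul_right 8

/-- For `D > 83² = 6889` with `D ≡ 4 (mod 105)`, every element of `𝒮_D` is
equivalent to an element of `𝒰_D`. -/
theorem stmt10 (D : ℤ) (hD : 6889 < D) (hmod : D % 105 = 4) (e : ℤ) (he : e ∈ SD D) :
    ∃ f ∈ UD D, Relation.EqvGen (SMove D) e f := by
  obtain ⟨s, hs, h1, h2⟩ := exists_floor_sqrt D hD
  obtain ⟨g, hg, hg1, hg2, heg⟩ := exists_eqvGen_le_neg_two hs h1 h2 e he
  suffices h : ∃ f ∈ UD D, Relation.EqvGen (SMove D) g f by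
    obtain ⟨f, hf, hgf⟩ := h
    exact ⟨f, hf, heg.trans _ _ _ hgf⟩
  have hs0 : 0 ≤ s := by omega
  have hgS := (mem_SD_iff hs0 h1 h2 g).1 hg
  by_cases hg105 : (105 : ℤ) ∣ g + 2
  swap
  · exact ⟨g, ⟨(mem_TD_iff hs0 h1 h2 g).2 ⟨hgS.1, hg1, by omega⟩, hg105⟩, .refl g⟩
  have hlt : g ^ 2 < D := hg.2.1
  have hTS : ∀ f ∈ TD D, f ∈ SD D := fun f hf => hf.1
  have hmodT : ∀ k : ℤ, 24 - s ≤ g + 4 * k → g + 4 * k ≤ s - 36 → g + 4 * k ∈ TD D :=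
    fun k h3 h4 => (mem_TD_iff hs0 h1 h2 _).2
      ⟨(sq_add_four_mul_emod g k).trans hgS.1, h3, h4⟩
  obtain ⟨q, hq, hqw, hqmin, hbound⟩ :=
    exists_least_prime_not_dvd ((D - g ^ 2) / 8) (by omega)
  have hq2 := hq.two_le
  have h8 : (8 : ℤ) ∣ D - g ^ 2 := by omega
  have h105 : (105 : ℤ) ∣ (D - g ^ 2) / 8 := by
    have h3 : (105 : ℤ) ∣ D - g ^ 2 := by
      obtain ⟨k, hk⟩ := hg105
      obtain ⟨l, hl⟩ : (105 : ℤ) ∣ D - 4 := by omega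
      exact ⟨l - k * (g - 2), by linear_combination hl - (g - 2) * hk⟩
    omega
  have hq4 : (q : ℤ) ≤ 13 ∨ 17 ≤ q ∧ 28 * (q : ℤ) ≤ s + 1 := by
    rcases hbound with h | ⟨h, h'⟩
    · left; exact_mod_cast h
    · refine Or.inr ⟨h, ?_⟩
      have h3 : (28 * (q : ℤ)) ^ 2 ≤ (s + 1) ^ 2 := by
        have : 800 * (q : ℤ) ^ 2 ≤ D - g ^ 2 := by omega
        nlinarith [sq_nonneg g]
      exact abs_le_of_sq_le_sq' h3 (by omega) |>.2
  have hT := hmodT ((q : ℤ) - 1) (by omega) (by omega)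
  have hmove := eqvGen_add hg (hTS _ hT) (by omega) (int_gcd_eq_one_of_prime_not_dvd hq hqw)
  by_cases hq105 : (105 : ℤ) ∣ (q : ℤ) - 1
  swap
  · exact ⟨_, ⟨hT, by omega⟩, hmove⟩
  have hq106 : 106 ≤ q := by omega
  obtain ⟨p, hp, hpq, hp3⟩ := exists_prime_dvd_mod_three_eq_two (q - 2) (by omega)
  have hple := Nat.le_of_dvd (by omega) hpq
  have hp2 : p ≠ 2 := by
    rintro rfl
    rcases hq.eq_two_or_odd with h | h <;> omega
  have hpq' : (p : ℤ) ∣ (q : ℤ) - 2 := by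
    have := Int.natCast_dvd_natCast.2 hpq
    rwa [Nat.cast_sub hq2] at this
  have hpg : (p : ℤ) ∣ D - g ^ 2 := by
    rw [← Int.ediv_mul_cancel h8]
    exact (hqmin p hp (by omega)).mul_right 8
  have hp1 := hp.two_le
  have hm1 := sq_add_four_mul_emod g ((q : ℤ) - 1)
  have hm2 := sq_add_four_mul_emod (g + 4 * ((q : ℤ) - 1)) 1
  rw [mul_one] at hm2
  rcases not_dvd_or_not_dvd_of_dvd_sub_two hp hp2 hpq' hpg with h | h
  · have hT' := hmodT ((q : ℤ) - 1 + (p - 1)) (by omega) (by omega)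
    rw [mul_add, ← add_assoc] at hT'
    exact ⟨_, ⟨hT', by omega⟩, hmove.trans _ _ _ (eqvGen_add (hTS _ hT) (hTS _ hT') (by omega)
      (int_gcd_eq_one_of_prime_not_dvd hp (not_dvd_ediv_eight (by omega) h)))⟩
  · have hT' := hmodT ((q : ℤ) - 1 - (p - 1)) (by omega) (by omega)
    rw [mul_sub, ← add_sub_assoc] at hT'
    exact ⟨_, ⟨hT', by omega⟩, hmove.trans _ _ _ (eqvGen_sub (hTS _ hT) (hTS _ hT') (by omega)
      (int_gcd_eq_one_of_prime_not_dvd hp (not_dvd_ediv_eight (by omega) h)))⟩
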